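/- arXiv:1903.05851 — 2 statements merged into one kernel-verified Lean document; each statement's English description precedes it below -/
import Mathlib

section
/- Let (Ω, 𝓕, P) be a probability space, let z be a positive natural number, let W, Θ1, Θ2 : Ω → ℝ be random variables with W², W²·Θ1², and Θ2² integrable, and let L : Ω → Fin z be a measurable random variable such that E[W²·1_{L = l}] > 0 for every l. Assume Θ2 is independent of the triple (W, Θ1, L) and E[Θ2] = 1. Define r* : Fin z → ℝ by r*(l) = E[W²·Θ1·1_{L = l}] / E[W²·1_{L = l}]. Then for every function r : Fin z → ℝ, E[(W·Θ1·Θ2 − W·r*(L))²] ≤ E[(W·Θ1·Θ2 − W·r(L))²]; that is, r* minimizes r ↦ E[(W·Θ1·Θ2 − W·r(L))²] over all r : Fin z → ℝ. -/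
open MeasureTheory ProbabilityTheory

theorem stmt_12 {Ω : Type*} [MeasurableSpace Ω] (P : Measure Ω) [IsProbabilityMeasure P]
    (z : ℕ) (hz : 0 < z)
    (W Θ1 Θ2 : Ω → ℝ) (hW : Measurable W) (hΘ1 : Measurable Θ1) (hΘ2 : Measurable Θ2)
    (hW2 : Integrable (fun ω => W ω ^ 2) P)
    (hWΘ1sq : Integrable (fun ω => W ω ^ 2 * Θ1 ω ^ 2) P)
    (hΘ2sq : Integrable (fun ω => Θ2 ω ^ 2) P)
    (L : Ω → Fin z) (hL : Measurable L)
    (hpos : ∀ l : Fin z, 0 < ∫ ω, W ω ^ 2 * (if L ω = l then (1 : ℝ) else 0) ∂P)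
    (hindep : IndepFun Θ2 (fun ω => (W ω, Θ1 ω, L ω)) P)
    (hEΘ2 : ∫ ω, Θ2 ω ∂P = 1)
    (rstar : Fin z → ℝ)
    (hrstar : rstar = fun l =>
      (∫ ω, W ω ^ 2 * Θ1 ω * (if L ω = l then (1 : ℝ) else 0) ∂P)
        / (∫ ω, W ω ^ 2 * (if L ω = l then (1 : ℝ) else 0) ∂P)) :
    ∀ r : Fin z → ℝ,
      (∫ ω, (W ω * Θ1 ω * Θ2 ω - W ω * rstar (L ω)) ^ 2 ∂P)
        ≤ ∫ ω, (W ω * Θ1 ω * Θ2 ω - W ω * r (L ω)) ^ 2 ∂P := by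
  intro r
  have hI : ∀ l : Fin z, Measurable (fun ω => if L ω = l then (1 : ℝ) else 0) := fun l =>
    Measurable.ite (hL (measurableSet_singleton l)) measurable_const measurable_const
  have hB : ∀ l : Fin z, Integrable (fun ω => W ω ^ 2 * (if L ω = l then (1 : ℝ) else 0)) P := by
    intro l
    refine hW2.mono' ((hW.pow_const 2).mul (hI l)).aestronglyMeasurable (ae_of_all _ fun ω => ?_)
    split_ifs <;> simp [sq_nonneg]
  have hA : ∀ l : Fin z,
      Integrable (fun ω => W ω ^ 2 * Θ1 ω * (if L ω = l then (1 : ℝ) else 0)) P := by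
    intro l
    refine (hW2.add hWΘ1sq).mono'
      (((hW.pow_const 2).mul hΘ1).mul (hI l)).aestronglyMeasurable (ae_of_all _ fun ω => ?_)
    have h1 : |Θ1 ω| ≤ 1 + Θ1 ω ^ 2 := by
      rw [abs_le]; constructor <;> nlinarith [sq_nonneg (Θ1 ω - 1), sq_nonneg (Θ1 ω + 1)]
    have h2 : W ω ^ 2 * |Θ1 ω| ≤ W ω ^ 2 * (1 + Θ1 ω ^ 2) :=
      mul_le_mul_of_nonneg_left h1 (sq_nonneg _)
    have h3 : 0 ≤ W ω ^ 2 * (1 + Θ1 ω ^ 2) := by positivity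
    simp only [Pi.add_apply, Real.norm_eq_abs]
    split_ifs
    · rw [mul_one, abs_mul, abs_of_nonneg (sq_nonneg (W ω))]; linarith
    · rw [mul_zero, abs_zero]; linarith
  have hT : Integrable Θ2 P := by
    refine ((integrable_const (1 : ℝ)).add hΘ2sq).mono' hΘ2.aestronglyMeasurable
      (ae_of_all _ fun ω => ?_)
    simp only [Pi.add_apply, Real.norm_eq_abs]
    rw [abs_le]; constructor <;> nlinarith [sq_nonneg (Θ2 ω - 1), sq_nonneg (Θ2 ω + 1)]
  have hindA : ∀ l : Fin z,
      IndepFun Θ2 (fun ω => W ω ^ 2 * Θ1 ω * (if L ω = l then (1 : ℝ) else 0)) P := by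
    intro l
    have hm : Measurable (fun p : ℝ × ℝ × Fin z =>
        p.1 ^ 2 * p.2.1 * (if p.2.2 = l then (1 : ℝ) else 0)) := by
      refine Measurable.mul (by fun_prop) (Measurable.ite ?_ measurable_const measurable_const)
      exact (measurable_snd.comp measurable_snd) (measurableSet_singleton l)
    exact hindep.comp measurable_id hm
  have hindC : IndepFun (fun ω => Θ2 ω ^ 2) (fun ω => W ω ^ 2 * Θ1 ω ^ 2) P := by
    have hm : Measurable (fun p : ℝ × ℝ × Fin z => p.1 ^ 2 * p.2.1 ^ 2) := by fun_prop
    have hm2 : Measurable (fun x : ℝ => x ^ 2) := by fun_prop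
    exact hindep.comp hm2 hm
  have hC : Integrable (fun ω => Θ2 ω ^ 2 * (W ω ^ 2 * Θ1 ω ^ 2)) P :=
    hindC.integrable_mul hΘ2sq hWΘ1sq
  have hAT : ∀ l : Fin z, Integrable
      (fun ω => Θ2 ω * (W ω ^ 2 * Θ1 ω * (if L ω = l then (1 : ℝ) else 0))) P :=
    fun l => (hindA l).integrable_mul hT (hA l)
  have hATe : ∀ l : Fin z,
      ∫ ω, Θ2 ω * (W ω ^ 2 * Θ1 ω * (if L ω = l then (1 : ℝ) else 0)) ∂P
        = ∫ ω, W ω ^ 2 * Θ1 ω * (if L ω = l then (1 : ℝ) else 0) ∂P := by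
    intro l
    rw [(hindA l).integral_fun_mul_eq_mul_integral hΘ2.aestronglyMeasurable
      (hA l).aestronglyMeasurable, hEΘ2, one_mul]
  have key : ∀ s : Fin z → ℝ, ∫ ω, (W ω * Θ1 ω * Θ2 ω - W ω * s (L ω)) ^ 2 ∂P
      = (∫ ω, Θ2 ω ^ 2 * (W ω ^ 2 * Θ1 ω ^ 2) ∂P) + ∑ l : Fin z,
        (s l ^ 2 * (∫ ω, W ω ^ 2 * (if L ω = l then (1 : ℝ) else 0) ∂P)
          - 2 * s l * (∫ ω, W ω ^ 2 * Θ1 ω * (if L ω = l then (1 : ℝ) else 0) ∂P)) := by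
    intro s
    have e : ∀ ω, (W ω * Θ1 ω * Θ2 ω - W ω * s (L ω)) ^ 2
        = Θ2 ω ^ 2 * (W ω ^ 2 * Θ1 ω ^ 2) + ∑ l : Fin z,
          (s l ^ 2 * (W ω ^ 2 * (if L ω = l then (1 : ℝ) else 0))
          - 2 * s l * (Θ2 ω * (W ω ^ 2 * Θ1 ω * (if L ω = l then (1 : ℝ) else 0)))) := by
      intro ω
      rw [Finset.sum_eq_single (L ω)]
      · simp only [if_true]; ring
      · intro b _ hb
        simp [hb.symm]
      · simp
    have hi : ∀ l : Fin z, Integrable (fun ω =>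
          s l ^ 2 * (W ω ^ 2 * (if L ω = l then (1 : ℝ) else 0))
          - 2 * s l * (Θ2 ω * (W ω ^ 2 * Θ1 ω * (if L ω = l then (1 : ℝ) else 0)))) P :=
      fun l => ((hB l).const_mul _).sub ((hAT l).const_mul _)
    simp_rw [e]
    rw [integral_add hC (integrable_finsetSum _ fun l _ => hi l),
      integral_finsetSum _ fun l _ => hi l]
    congr 1
    refine Finset.sum_congr rfl fun l _ => ?_
    rw [integral_sub ((hB l).const_mul _) ((hAT l).const_mul _), integral_const_mul,
      integral_const_mul, hATe]
  rw [key, key]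
  refine add_le_add le_rfl (Finset.sum_le_sum fun l _ => ?_)
  have hb := hpos l
  simp only [hrstar]
  generalize (∫ ω, W ω ^ 2 * (if L ω = l then (1 : ℝ) else 0) ∂P) = b at hb ⊢
  generalize (∫ ω, W ω ^ 2 * Θ1 ω * (if L ω = l then (1 : ℝ) else 0) ∂P) = a
  obtain ⟨q, rfl⟩ : ∃ q, a = q * b := ⟨a / b, by field_simp⟩
  have hq : q * b / b = q := by field_simp
  simp only [hq]
  nlinarith [mul_nonneg hb.le (sq_nonneg (r l - q))]
end

section
/- Let (Ω, 𝓕, P) be a probability space, let z be a positive natural number, let Λ1, Λ2, Θ1 : Ω → ℝ be random variables with Λ1², Λ1²·Θ1, Λ1²·Λ2², and Λ1²·Λ2²·Θ1 integrable, and let L : Ω → Fin z be a measurable random variable. Assume Λ2 is independent of the triple (Λ1, Θ1, L), 0 < E[Λ2²] < ∞, and E[Λ1²·1_{L = l}] > 0 for every l. Then for every l, E[Λ1²·Λ2²·Θ1·1_{L = l}] / E[Λ1²·Λ2²·1_{L = l}] = E[Λ1²·Θ1·1_{L = l}] / E[Λ1²·1_{L = l}]. -/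
open MeasureTheory ProbabilityTheory

theorem stmt_13 {Ω : Type*} [MeasurableSpace Ω] (P : Measure Ω) [IsProbabilityMeasure P]
    (z : ℕ) (hz : 0 < z)
    (Λ1 Λ2 Θ1 : Ω → ℝ) (hΛ1 : Measurable Λ1) (hΛ2 : Measurable Λ2) (hΘ1 : Measurable Θ1)
    (hint1 : Integrable (fun ω => Λ1 ω ^ 2) P)
    (hint2 : Integrable (fun ω => Λ1 ω ^ 2 * Θ1 ω) P)
    (hint3 : Integrable (fun ω => Λ1 ω ^ 2 * Λ2 ω ^ 2) P)
    (hint4 : Integrable (fun ω => Λ1 ω ^ 2 * Λ2 ω ^ 2 * Θ1 ω) P)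
    (L : Ω → Fin z) (hL : Measurable L)
    (hindep : IndepFun Λ2 (fun ω => (Λ1 ω, Θ1 ω, L ω)) P)
    (hΛ2sqInt : Integrable (fun ω => Λ2 ω ^ 2) P)
    (hΛ2sqPos : 0 < ∫ ω, Λ2 ω ^ 2 ∂P)
    (hpos : ∀ l : Fin z, 0 < ∫ ω, Λ1 ω ^ 2 * (if L ω = l then (1 : ℝ) else 0) ∂P) :
    ∀ l : Fin z,
      (∫ ω, Λ1 ω ^ 2 * Λ2 ω ^ 2 * Θ1 ω * (if L ω = l then (1 : ℝ) else 0) ∂P)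
          / (∫ ω, Λ1 ω ^ 2 * Λ2 ω ^ 2 * (if L ω = l then (1 : ℝ) else 0) ∂P)
        = (∫ ω, Λ1 ω ^ 2 * Θ1 ω * (if L ω = l then (1 : ℝ) else 0) ∂P)
          / (∫ ω, Λ1 ω ^ 2 * (if L ω = l then (1 : ℝ) else 0) ∂P) := by
  intro l
  have key : ∀ g : ℝ × ℝ × Fin z → ℝ, Measurable g →
      ∫ ω, Λ2 ω ^ 2 * g (Λ1 ω, Θ1 ω, L ω) ∂P
        = (∫ ω, Λ2 ω ^ 2 ∂P) * ∫ ω, g (Λ1 ω, Θ1 ω, L ω) ∂P := by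
    intro g hg
    have h := hindep.comp (φ := fun x : ℝ => x ^ 2) (ψ := g) (by fun_prop) hg
    exact h.integral_fun_mul_eq_mul_integral
      (by fun_prop)
      ((hg.comp (hΛ1.prodMk (hΘ1.prodMk hL))).aestronglyMeasurable)
  have hi : Measurable (fun p : ℝ × ℝ × Fin z => if p.2.2 = l then (1 : ℝ) else 0) :=
    Measurable.ite (measurable_snd.snd (measurableSet_singleton l))
      measurable_const measurable_const
  have h1 := key (fun p => p.1 ^ 2 * p.2.1 * (if p.2.2 = l then (1 : ℝ) else 0))
    (by fun_prop)
  have h2 := key (fun p => p.1 ^ 2 * (if p.2.2 = l then (1 : ℝ) else 0))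
    (by fun_prop)
  have e1 : ∀ ω, Λ1 ω ^ 2 * Λ2 ω ^ 2 * Θ1 ω * (if L ω = l then (1 : ℝ) else 0)
      = Λ2 ω ^ 2 * (Λ1 ω ^ 2 * Θ1 ω * (if L ω = l then (1 : ℝ) else 0)) := fun ω => by ring
  have e2 : ∀ ω, Λ1 ω ^ 2 * Λ2 ω ^ 2 * (if L ω = l then (1 : ℝ) else 0)
      = Λ2 ω ^ 2 * (Λ1 ω ^ 2 * (if L ω = l then (1 : ℝ) else 0)) := fun ω => by ring
  simp_rw [e1, e2]
  dsimp only at h1 h2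
  rw [h1, h2]
  exact mul_div_mul_left _ _ hΛ2sqPos.ne'
end
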